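/- Let (p^x) be a transition family for the lifted chain L, let r be a probability distribution on S × ℤ^n with finite entropy h₀ = H[r] < ∞, and let p(t) = Σ_x r(x)·p^x(t). Then there exist a constant C > 0 (depending only on S, q, n and v) and a time T₀ ≥ 2 such that H[p(t)] ≤ h₀ + C·log t for all t ≥ T₀; in particular, H[p(t)]/t → 0 as t → ∞. -/

import Mathlib

open Filter
open scoped ENNReal

noncomputable section

/-- Right-hand side of the master equation of the lifted chain `L` at state `x`. -/
def mEqDeriv {S : Type} [Fintype S] [DecidableEq S] {n : ℕ}
    (q : S → S → ℝ) (v : S → S → (Fin n → ℤ))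
    (f : S × (Fin n → ℤ) → ℝ) (x : S × (Fin n → ℤ)) : ℝ :=
  ∑ j ∈ Finset.univ.erase x.1,
    (f (j, x.2 + v x.1 j) * q j x.1 - f x * q x.1 j)

/-- `p` is a solution of the master equation of the lifted chain `L`. -/
def IsMasterSolution {S : Type} [Fintype S] [DecidableEq S] {n : ℕ}
    (q : S → S → ℝ) (v : S → S → (Fin n → ℤ))
    (p : ℝ → S × (Fin n → ℤ) → ℝ) : Prop :=
  (∀ t : ℝ, 0 ≤ t → (∀ x, 0 ≤ p t x) ∧ (∑' x, p t x) = 1) ∧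
  (∀ (x : S × (Fin n → ℤ)) (t : ℝ), 0 ≤ t →
    HasDerivWithinAt (fun s => p s x) (mEqDeriv q v (p t) x) (Set.Ici 0) t)

/-- A transition family for the lifted chain `L`. -/
def IsTransitionFamily {S : Type} [Fintype S] [DecidableEq S] {n : ℕ}
    (q : S → S → ℝ) (v : S → S → (Fin n → ℤ))
    (P : S × (Fin n → ℤ) → ℝ → S × (Fin n → ℤ) → ℝ) : Prop :=
  (∀ x, IsMasterSolution q v (P x)) ∧
  (∀ x, P x 0 x = 1 ∧ ∀ y, y ≠ x → P x 0 y = 0) ∧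
  (∀ x z : S × (Fin n → ℤ), ∀ s t : ℝ, 0 ≤ s → 0 ≤ t →
    P x (s + t) z = ∑' y, P x s y * P y t z)

/-- Entropy (with values in `[0,∞]`) of a distribution on a countable set. -/
def HentE {X : Type*} (r : X → ℝ) : ℝ≥0∞ :=
  ∑' x, ENNReal.ofReal (Real.negMulLog (r x))

lemma summable_of_tsum_eq_one {X : Type*} {f : X → ℝ} (h : ∑' x, f x = 1) : Summable f := by
  by_contra hf
  rw [tsum_eq_zero_of_not_summable hf] at h
  exact zero_ne_one h

lemma tsum_ofReal_eq_one {X : Type*} {f : X → ℝ} (h0 : ∀ x, 0 ≤ f x) (h : ∑' x, f x = 1) :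
    ∑' x, ENNReal.ofReal (f x) = 1 := by
  rw [← ENNReal.ofReal_tsum_of_nonneg h0 (summable_of_tsum_eq_one h), h, ENNReal.ofReal_one]

lemma le_one_of_tsum_eq_one {X : Type*} {f : X → ℝ} (h0 : ∀ x, 0 ≤ f x) (h : ∑' x, f x = 1)
    (x : X) : f x ≤ 1 :=
  h ▸ (summable_of_tsum_eq_one h).le_tsum x fun y _ => h0 y

/-- Countable subadditivity of `x ↦ -x log x`. -/
lemma ofReal_negMulLog_tsum_le {X : Type*} {a : X → ℝ} (h0 : ∀ x, 0 ≤ a x) (hs : Summable a)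
    (h1 : ∑' x, a x ≤ 1) :
    ENNReal.ofReal (Real.negMulLog (∑' x, a x)) ≤
      ∑' x, ENNReal.ofReal (Real.negMulLog (a x)) := by
  set s := ∑' x, a x with hsdef
  have hs0 : 0 ≤ s := tsum_nonneg h0
  have hl : 0 ≤ -Real.log s := neg_nonneg.2 (Real.log_nonpos hs0 h1)
  have key : Real.negMulLog s = ∑' x, a x * -Real.log s := by
    rw [tsum_mul_right, ← hsdef, Real.negMulLog]; ring
  rw [key, ENNReal.ofReal_tsum_of_nonneg (fun x => mul_nonneg (h0 x) hl) (hs.mul_right _)]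
  refine ENNReal.tsum_le_tsum fun x => ENNReal.ofReal_le_ofReal ?_
  rcases (h0 x).eq_or_lt with h | h
  · simp [← h]
  · have hle : a x ≤ s := hs.le_tsum x fun y _ => h0 y
    have := Real.log_le_log h hle
    rw [Real.negMulLog]
    nlinarith

/-- The entropy of a mixture is at most the entropy of the weights plus a uniform bound on the
entropies of the components. -/
lemma HentE_mixture_le {X Y : Type*} {r : X → ℝ} {p : X → Y → ℝ} {M : ℝ≥0∞}
    (hr0 : ∀ x, 0 ≤ r x) (hr1 : ∑' x, r x = 1)
    (hp0 : ∀ x y, 0 ≤ p x y) (hp1 : ∀ x, ∑' y, p x y = 1) (hM : ∀ x, HentE (p x) ≤ M) :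
    HentE (fun y => ∑' x, r x * p x y) ≤ HentE r + M := by
  have hrs := summable_of_tsum_eq_one hr1
  have hple : ∀ x y, p x y ≤ 1 := fun x y => le_one_of_tsum_eq_one (hp0 x) (hp1 x) y
  have hle : ∀ x y, r x * p x y ≤ r x := fun x y => mul_le_of_le_one_right (hr0 x) (hple x y)
  have hnn : ∀ x y, 0 ≤ r x * p x y := fun x y => mul_nonneg (hr0 x) (hp0 x y)
  have hsum : ∀ y, Summable fun x => r x * p x y := fun y =>
    hrs.of_nonneg_of_le (fun x => hnn x y) fun x => hle x y
  calc HentE (fun y => ∑' x, r x * p x y)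
      ≤ ∑' y, ∑' x, ENNReal.ofReal (Real.negMulLog (r x * p x y)) :=
        ENNReal.tsum_le_tsum fun y => ofReal_negMulLog_tsum_le (fun x => hnn x y) (hsum y)
          (hr1 ▸ (hsum y).tsum_le_tsum (fun x => hle x y) hrs)
    _ = ∑' x, ∑' y, ENNReal.ofReal (Real.negMulLog (r x * p x y)) := ENNReal.tsum_comm
    _ ≤ ∑' x, (ENNReal.ofReal (Real.negMulLog (r x)) + ENNReal.ofReal (r x) * M) := by
        refine ENNReal.tsum_le_tsum fun x => ?_
        calc ∑' y, ENNReal.ofReal (Real.negMulLog (r x * p x y))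
            ≤ ∑' y, (ENNReal.ofReal (p x y) * ENNReal.ofReal (Real.negMulLog (r x)) +
                ENNReal.ofReal (r x) * ENNReal.ofReal (Real.negMulLog (p x y))) := by
              refine ENNReal.tsum_le_tsum fun y => ?_
              rw [Real.negMulLog_mul, ← ENNReal.ofReal_mul (hp0 x y),
                ← ENNReal.ofReal_mul (hr0 x)]
              exact ENNReal.ofReal_add_le
          _ = ENNReal.ofReal (Real.negMulLog (r x)) + ENNReal.ofReal (r x) * HentE (p x) := by
              rw [ENNReal.tsum_add, ENNReal.tsum_mul_right, ENNReal.tsum_mul_left,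
                tsum_ofReal_eq_one (hp0 x) (hp1 x), one_mul, HentE]
          _ ≤ _ := by gcongr; exact hM x
    _ = HentE r + M := by
        rw [ENNReal.tsum_add, ENNReal.tsum_mul_right, tsum_ofReal_eq_one hr0 hr1, one_mul, HentE]

lemma tsum_pi_prod_eq_pow (g : ℤ → ℝ≥0∞) (n : ℕ) :
    ∑' a : Fin n → ℤ, ∏ k, g (a k) = (∑' m, g m) ^ n := by
  induction n with
  | zero => simp
  | succ n ih =>
    rw [← (Fin.consEquiv fun _ : Fin (n + 1) => ℤ).tsum_eq, ENNReal.tsum_prod']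
    simp only [Fin.consEquiv_apply, Fin.prod_univ_succ, Fin.cons_zero, Fin.cons_succ,
      ENNReal.tsum_mul_left, ih, ENNReal.tsum_mul_right]
    rw [pow_succ']

lemma tsum_inv_one_add_abs_sq_ne_top :
    ∑' m : ℤ, ENNReal.ofReal (((1 + |(m : ℝ)|) ^ 2)⁻¹) ≠ ⊤ := by
  have hs : Summable fun m : ℤ => ((1 + |(m : ℝ)|) ^ 2)⁻¹ := by
    have hnat : Summable fun m : ℕ => ((1 + |((m : ℤ) : ℝ)|) ^ 2)⁻¹ := by
      have := (summable_nat_add_iff 1).2 (Real.summable_nat_pow_inv.2 (by norm_num : 1 < 2))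
      refine this.congr fun m => ?_
      rw [Int.cast_natCast, abs_of_nonneg (Nat.cast_nonneg m)]
      push_cast
      ring
    refine Summable.of_nat_of_neg hnat ?_
    simpa using hnat
  exact hs.tsum_ofReal_ne_top

/-- The product weight `∏ₖ (1 + |aₖ|)⁻²` on `ℤⁿ`. -/
def polyWeight {n : ℕ} (a : Fin n → ℤ) : ℝ := ∏ k, ((1 + |(a k : ℝ)|) ^ 2)⁻¹

lemma polyWeight_pos {n : ℕ} (a : Fin n → ℤ) : 0 < polyWeight a :=
  Finset.prod_pos fun k _ => by positivity

lemma tsum_polyWeight_ne_top {n : ℕ} :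
    ∑' a : Fin n → ℤ, ENNReal.ofReal (polyWeight a) ≠ ⊤ := by
  have h : ∀ a : Fin n → ℤ, ENNReal.ofReal (polyWeight a) =
      ∏ k, ENNReal.ofReal (((1 + |(a k : ℝ)|) ^ 2)⁻¹) := fun a =>
    ENNReal.ofReal_prod_of_nonneg fun k _ => by positivity
  simp only [h]
  rw [tsum_pi_prod_eq_pow fun m : ℤ => ENNReal.ofReal (((1 + |(m : ℝ)|) ^ 2)⁻¹)]
  exact ENNReal.pow_ne_top tsum_inv_one_add_abs_sq_ne_top

lemma neg_log_polyWeight_le {n : ℕ} (a : Fin n → ℤ) :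
    -Real.log (polyWeight a) ≤ 2 * n * Real.log (1 + ‖a‖) := by
  rw [polyWeight, Real.log_prod fun k _ => by positivity, ← Finset.sum_neg_distrib]
  calc ∑ k, -Real.log (((1 + |(a k : ℝ)|) ^ 2)⁻¹)
      ≤ ∑ _k : Fin n, 2 * Real.log (1 + ‖a‖) := by
        refine Finset.sum_le_sum fun k _ => ?_
        rw [Real.log_inv, neg_neg, Real.log_pow]
        have h : |(a k : ℝ)| ≤ ‖a‖ := by
          simpa [Int.norm_eq_abs] using norm_le_pi_norm a k
        push_cast
        gcongr
    _ = _ := by simp; ring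

/-- Gibbs-type bound against an unnormalised weight. -/
lemma negMulLog_le_mul_neg_log_add {p g : ℝ} (hp : 0 ≤ p) (hg : 0 < g) :
    Real.negMulLog p ≤ p * -Real.log g + g := by
  rcases hp.eq_or_lt with rfl | hp
  · simpa using hg.le
  · have h := Real.log_le_sub_one_of_pos (div_pos hg hp)
    rw [Real.log_div hg.ne' hp.ne'] at h
    have h2 := mul_le_mul_of_nonneg_left h hp.le
    have h3 : p * (g / p - 1) = g - p := by field_simp
    rw [h3] at h2
    rw [Real.negMulLog]
    nlinarith

lemma log_one_add_le {t ρ : ℝ} (ht : 0 ≤ t) (hρ : 0 ≤ ρ) :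
    Real.log (1 + ρ) ≤ Real.log (1 + t) + ρ / (1 + t) := by
  have h := Real.log_le_sub_one_of_pos (div_pos (by linarith : 0 < 1 + ρ) (by linarith : 0 < 1 + t))
  rw [Real.log_div (by linarith) (by linarith)] at h
  have h2 : (1 + ρ) / (1 + t) - 1 ≤ ρ / (1 + t) := by
    have h1t : 0 < 1 + t := by linarith
    rw [add_div]
    have : 1 / (1 + t) ≤ 1 := (div_le_one h1t).2 (by linarith)
    linarith
  linarith

section Chain

variable {S : Type} [Fintype S] [DecidableEq S] {n : ℕ}

/-- A bound on the expected displacement rate of the lifted chain. -/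
def driftBound (q : S → S → ℝ) (v : S → S → (Fin n → ℤ)) : ℝ :=
  ∑ i, ∑ j ∈ Finset.univ.erase i, q j i * ‖v i j‖

lemma driftBound_nonneg {q : S → S → ℝ} (hq : ∀ i j : S, i ≠ j → 0 ≤ q i j)
    (v : S → S → (Fin n → ℤ)) : 0 ≤ driftBound q v :=
  Finset.sum_nonneg fun i _ => Finset.sum_nonneg fun j hj =>
    mul_nonneg (hq j i (Finset.ne_of_mem_erase hj)) (norm_nonneg _)

/-- Testing the master equation against a finitely supported `1`-Lipschitz function. -/
lemma neg_driftBound_le_sum_mEqDeriv {q : S → S → ℝ} (hq : ∀ i j : S, i ≠ j → 0 ≤ q i j)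
    (v : S → S → (Fin n → ℤ)) {f : S × (Fin n → ℤ) → ℝ} (hf0 : ∀ x, 0 ≤ f x)
    (hf1 : ∑' x, f x = 1) {ψ : (Fin n → ℤ) → ℝ} {R : ℝ} (hψ0 : ∀ a, 0 ≤ ψ a) (hψR : ∀ a, ψ a ≤ R)
    (hψL : ∀ a b, ψ a ≤ ψ (a - b) + ‖b‖) (B : Finset (Fin n → ℤ)) (hB : ∀ a ∉ B, ψ a = 0) :
    -driftBound q v ≤ ∑ i, ∑ a ∈ B, ψ a * mEqDeriv q v f (i, a) := by
  have hfs := summable_of_tsum_eq_one hf1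
  have hfi : ∀ i, Summable fun a => f (i, a) := fun i => hfs.prod_factor i
  have hfi1 : ∀ i, ∑' a, f (i, a) ≤ 1 := fun i =>
    hf1 ▸ tsum_comp_le_tsum_of_inj hfs hf0 (Prod.mk_right_injective i)
  have hsh : ∀ j b, Summable fun a => ψ (a - b) * f (j, a) := fun j b =>
    ((hfi j).mul_left R).of_nonneg_of_le (fun a => mul_nonneg (hψ0 _) (hf0 _))
      fun a => mul_le_mul_of_nonneg_right (hψR _) (hf0 _)
  set A : S → ℝ := fun i => ∑ a ∈ B, ψ a * f (i, a) with hA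
  have hAt : ∀ i, A i = ∑' a, ψ a * f (i, a) := fun i =>
    (tsum_eq_sum fun a ha => by rw [hB a ha, zero_mul]).symm
  have hshift : ∀ j b, A j - ‖b‖ ≤ ∑ a ∈ B, ψ a * f (j, a + b) := by
    intro j b
    have h1 : ∑ a ∈ B, ψ a * f (j, a + b) = ∑' a, ψ (a - b) * f (j, a) := by
      have h : ∑' a, ψ a * f (j, a + b) = ∑ a ∈ B, ψ a * f (j, a + b) :=
        tsum_eq_sum fun a ha => by rw [hB a ha, zero_mul]
      rw [← h, ← (Equiv.addRight b).tsum_eq fun a => ψ (a - b) * f (j, a)]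
      simp
    have h0 : Summable fun a => ψ a * f (j, a) := by simpa using hsh j 0
    have h2 : A j ≤ ∑' a, (ψ (a - b) * f (j, a) + ‖b‖ * f (j, a)) := by
      rw [hAt]
      refine h0.tsum_le_tsum (fun a => ?_) ((hsh j b).add ((hfi j).mul_left _))
      rw [← add_mul]
      exact mul_le_mul_of_nonneg_right (hψL a b) (hf0 _)
    rw [(hsh j b).tsum_add ((hfi j).mul_left _), tsum_mul_left] at h2
    have h3 := mul_le_mul_of_nonneg_left (hfi1 j) (norm_nonneg b)
    rw [h1]
    linarith
  have hexp : ∀ i, ∑ a ∈ B, ψ a * mEqDeriv q v f (i, a) =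
      ∑ j ∈ Finset.univ.erase i,
        (q j i * ∑ a ∈ B, ψ a * f (j, a + v i j) - q i j * A i) := by
    intro i
    simp only [mEqDeriv, hA, Finset.mul_sum, ← Finset.sum_sub_distrib]
    rw [Finset.sum_comm]
    refine Finset.sum_congr rfl fun j _ => Finset.sum_congr rfl fun a _ => ?_
    ring
  have hcomm : ∑ i, ∑ j ∈ Finset.univ.erase i, q j i * A j =
      ∑ i, ∑ j ∈ Finset.univ.erase i, q i j * A i :=
    Finset.sum_comm' fun x y => by simp [eq_comm]
  calc -driftBound q v
      = ∑ i, ∑ j ∈ Finset.univ.erase i, (q j i * (A j - ‖v i j‖) - q i j * A i) := by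
        simp only [mul_sub, Finset.sum_sub_distrib, hcomm, driftBound]
        ring
    _ ≤ _ := by
        simp only [hexp]
        refine Finset.sum_le_sum fun i _ => Finset.sum_le_sum fun j hj => ?_
        have := mul_le_mul_of_nonneg_left (hshift j (v i j)) (hq j i (Finset.ne_of_mem_erase hj))
        linarith

/-- The first moment of the displacement grows at most linearly. -/
lemma tsum_ofReal_mul_norm_le {q : S → S → ℝ} (hq : ∀ i j : S, i ≠ j → 0 ≤ q i j)
    (v : S → S → (Fin n → ℤ)) {p : ℝ → S × (Fin n → ℤ) → ℝ} (hp : IsMasterSolution q v p)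
    {x : S × (Fin n → ℤ)} (hx : p 0 x = 1) {t : ℝ} (ht : 0 ≤ t) :
    ∑' y, ENNReal.ofReal (p t y * ‖y.2 - x.2‖) ≤ ENNReal.ofReal (driftBound q v * t) := by
  rw [ENNReal.tsum_eq_iSup_sum]
  refine iSup_le fun T => ?_
  have hp0 := (hp.1 t ht).1
  rw [← ENNReal.ofReal_sum_of_nonneg fun y _ => mul_nonneg (hp0 y) (norm_nonneg _)]
  refine ENNReal.ofReal_le_ofReal ?_
  set R : ℝ := ∑ y ∈ T, ‖y.2 - x.2‖ with hR
  have hR0 : 0 ≤ R := Finset.sum_nonneg fun _ _ => norm_nonneg _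
  have hTR : ∀ y ∈ T, ‖y.2 - x.2‖ ≤ R := fun y hy =>
    Finset.single_le_sum (f := fun y : S × (Fin n → ℤ) => ‖y.2 - x.2‖)
      (fun _ _ => norm_nonneg _) hy
  have hfin : (Metric.closedBall x.2 R).Finite :=
    (isCompact_closedBall x.2 R).finite_of_discrete
  set B : Finset (Fin n → ℤ) := hfin.toFinset with hBdef
  have hBmem : ∀ a, a ∈ B ↔ ‖a - x.2‖ ≤ R := fun a => by
    simp [hBdef, dist_eq_norm]
  set ψ : (Fin n → ℤ) → ℝ := fun a => max (R - ‖a - x.2‖) 0 with hψ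
  have hψ0 : ∀ a, 0 ≤ ψ a := fun a => le_max_right _ _
  have hψR : ∀ a, ψ a ≤ R := fun a => max_le (by linarith [norm_nonneg (a - x.2)]) hR0
  have hψL : ∀ a b, ψ a ≤ ψ (a - b) + ‖b‖ := by
    intro a b
    have h1 : ‖a - b - x.2‖ ≤ ‖a - x.2‖ + ‖b‖ := by
      rw [sub_right_comm]; exact norm_sub_le _ _
    have h2 : R - ‖a - b - x.2‖ ≤ ψ (a - b) := le_max_left _ _
    exact max_le (by linarith) (add_nonneg (hψ0 _) (norm_nonneg _))
  have hψB : ∀ a ∉ B, ψ a = 0 := by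
    intro a ha
    rw [hBmem, not_le] at ha
    exact max_eq_right (by linarith)
  set F : ℝ → ℝ := fun s => ∑ i, ∑ a ∈ B, ψ a * p s (i, a) with hF
  have hder : ∀ s, 0 ≤ s → HasDerivWithinAt (fun s => F s + driftBound q v * s)
      (∑ i, ∑ a ∈ B, ψ a * mEqDeriv q v (p s) (i, a) + driftBound q v) (Set.Ici 0) s := by
    intro s hs
    refine HasDerivWithinAt.add ?_ ?_
    · exact HasDerivWithinAt.fun_sum fun i _ => HasDerivWithinAt.fun_sum fun a _ =>
        (hp.2 (i, a) s hs).const_mul _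
    · simpa using (hasDerivWithinAt_id s (Set.Ici 0)).const_mul (driftBound q v)
  have hmono : MonotoneOn (fun s => F s + driftBound q v * s) (Set.Ici 0) := by
    refine monotoneOn_of_hasDerivWithinAt_nonneg (convex_Ici 0)
      (fun s hs => (hder s hs).continuousWithinAt)
      (fun s hs => (hder s (interior_subset hs)).mono interior_subset) fun s hs => ?_
    have hs0 : 0 ≤ s := interior_subset (s := Set.Ici (0 : ℝ)) hs
    have := neg_driftBound_le_sum_mEqDeriv hq v (hp.1 s hs0).1 (hp.1 s hs0).2 hψ0 hψR hψL B hψB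
    linarith
  have hF0 : R ≤ F 0 := by
    have h00 := (hp.1 0 le_rfl).1
    have hxB : x.2 ∈ B := by rw [hBmem]; simpa using hR0
    have h1 : ψ x.2 * p 0 (x.1, x.2) ≤ ∑ a ∈ B, ψ a * p 0 (x.1, a) :=
      Finset.single_le_sum (f := fun a => ψ a * p 0 (x.1, a))
        (fun a _ => mul_nonneg (hψ0 a) (h00 _)) hxB
    have h2 : ∑ a ∈ B, ψ a * p 0 (x.1, a) ≤ F 0 :=
      Finset.single_le_sum (f := fun i => ∑ a ∈ B, ψ a * p 0 (i, a))
        (fun i _ => Finset.sum_nonneg fun a _ => mul_nonneg (hψ0 a) (h00 _)) (Finset.mem_univ x.1)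
    have h3 : ψ x.2 = R := by simp [hψ, hR0]
    rw [Prod.mk.eta, hx, h3, mul_one] at h1
    exact h1.trans h2
  have hmt := hmono (Set.mem_Ici.2 le_rfl) (Set.mem_Ici.2 ht) ht
  have hTB : T ⊆ Finset.univ ×ˢ B := fun y hy => by simp [hBmem, hTR y hy]
  have hFt : F t = ∑ y ∈ Finset.univ ×ˢ B, ψ y.2 * p t y := by
    rw [Finset.sum_product]
  have hmass : ∑ y ∈ Finset.univ ×ˢ B, p t y ≤ 1 :=
    (hp.1 t ht).2 ▸ (summable_of_tsum_eq_one (hp.1 t ht).2).sum_le_tsum _ fun y _ => hp0 y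
  calc ∑ y ∈ T, p t y * ‖y.2 - x.2‖
      ≤ ∑ y ∈ T, p t y * (R - ψ y.2) := by
        refine Finset.sum_le_sum fun y hy => mul_le_mul_of_nonneg_left ?_ (hp0 y)
        rw [hψ]
        simp only
        rw [max_eq_left (by linarith [hTR y hy])]
        linarith
    _ ≤ ∑ y ∈ Finset.univ ×ˢ B, p t y * (R - ψ y.2) :=
        Finset.sum_le_sum_of_subset_of_nonneg hTB fun y _ _ =>
          mul_nonneg (hp0 y) (sub_nonneg.2 (hψR _))
    _ = R * ∑ y ∈ Finset.univ ×ˢ B, p t y - F t := by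
        rw [hFt, Finset.mul_sum, ← Finset.sum_sub_distrib]
        exact Finset.sum_congr rfl fun y _ => by ring
    _ ≤ driftBound q v * t := by
        have := mul_le_mul_of_nonneg_left hmass hR0
        simp only [mul_zero, add_zero] at hmt
        linarith

lemma HentE_masterSolution_le {q : S → S → ℝ} (hq : ∀ i j : S, i ≠ j → 0 ≤ q i j)
    (v : S → S → (Fin n → ℤ)) {p : ℝ → S × (Fin n → ℤ) → ℝ} (hp : IsMasterSolution q v p)
    {x : S × (Fin n → ℤ)} (hx : p 0 x = 1) {t : ℝ} (ht : 0 ≤ t) :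
    HentE (p t) ≤ ENNReal.ofReal (2 * n * (Real.log (1 + t) + driftBound q v) +
      Fintype.card S * (∑' a : Fin n → ℤ, ENNReal.ofReal (polyWeight a)).toReal) := by
  have hp0 := (hp.1 t ht).1
  have h1t : 0 < 1 + t := by linarith
  have hL : 0 ≤ Real.log (1 + t) := Real.log_nonneg (by linarith)
  have hD := driftBound_nonneg hq v
  have hweight : ∑' y : S × (Fin n → ℤ), ENNReal.ofReal (polyWeight (y.2 - x.2)) =
      ENNReal.ofReal
        (Fintype.card S * (∑' a : Fin n → ℤ, ENNReal.ofReal (polyWeight a)).toReal) := by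
    rw [ENNReal.tsum_prod']
    have h : ∑' a : Fin n → ℤ, ENNReal.ofReal (polyWeight (a - x.2)) =
        ∑' a : Fin n → ℤ, ENNReal.ofReal (polyWeight a) :=
      (Equiv.subRight x.2).tsum_eq fun a => ENNReal.ofReal (polyWeight a)
    simp only [h, tsum_fintype, Finset.sum_const, Finset.card_univ, nsmul_eq_mul]
    rw [ENNReal.ofReal_mul (Nat.cast_nonneg _), ENNReal.ofReal_natCast,
      ENNReal.ofReal_toReal tsum_polyWeight_ne_top]
  have hpt : ∀ y, ENNReal.ofReal (Real.negMulLog (p t y)) ≤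
      ENNReal.ofReal (2 * n * Real.log (1 + t)) * ENNReal.ofReal (p t y) +
      ENNReal.ofReal (2 * n / (1 + t)) * ENNReal.ofReal (p t y * ‖y.2 - x.2‖) +
      ENNReal.ofReal (polyWeight (y.2 - x.2)) := by
    intro y
    rw [← ENNReal.ofReal_mul (by positivity), ← ENNReal.ofReal_mul (by positivity),
      ← ENNReal.ofReal_add (mul_nonneg (by positivity) (hp0 y))
        (mul_nonneg (by positivity) (mul_nonneg (hp0 y) (norm_nonneg _))),
      ← ENNReal.ofReal_add (add_nonneg (mul_nonneg (by positivity) (hp0 y))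
        (mul_nonneg (by positivity) (mul_nonneg (hp0 y) (norm_nonneg _)))) (polyWeight_pos _).le]
    refine ENNReal.ofReal_le_ofReal ?_
    refine (negMulLog_le_mul_neg_log_add (hp0 y) (polyWeight_pos (y.2 - x.2))).trans ?_
    gcongr
    have h1 := neg_log_polyWeight_le (y.2 - x.2)
    have h2 := mul_le_mul_of_nonneg_left (log_one_add_le ht (norm_nonneg (y.2 - x.2)))
      (by positivity : (0 : ℝ) ≤ 2 * n)
    refine (mul_le_mul_of_nonneg_left (h1.trans h2) (hp0 y)).trans_eq ?_
    ring
  calc HentE (p t) ≤ _ := ENNReal.tsum_le_tsum hpt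
    _ = ENNReal.ofReal (2 * n * Real.log (1 + t)) +
        ENNReal.ofReal (2 * n / (1 + t)) * ∑' y, ENNReal.ofReal (p t y * ‖y.2 - x.2‖) +
        ∑' y : S × (Fin n → ℤ), ENNReal.ofReal (polyWeight (y.2 - x.2)) := by
        rw [ENNReal.tsum_add, ENNReal.tsum_add, ENNReal.tsum_mul_left, ENNReal.tsum_mul_left,
          tsum_ofReal_eq_one hp0 (hp.1 t ht).2, mul_one]
    _ ≤ ENNReal.ofReal (2 * n * Real.log (1 + t)) +
        ENNReal.ofReal (2 * n / (1 + t)) * ENNReal.ofReal (driftBound q v * t) +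
        ENNReal.ofReal
          (Fintype.card S * (∑' a : Fin n → ℤ, ENNReal.ofReal (polyWeight a)).toReal) := by
        rw [hweight]
        gcongr
        exact tsum_ofReal_mul_norm_le hq v hp hx ht
    _ ≤ _ := by
        rw [← ENNReal.ofReal_mul (by positivity), ← ENNReal.ofReal_add (by positivity)
          (by positivity), ← ENNReal.ofReal_add (by positivity) (by positivity)]
        refine ENNReal.ofReal_le_ofReal ?_
        gcongr
        have h : 2 * n / (1 + t) * (driftBound q v * t) =
            2 * n * driftBound q v * (t / (1 + t)) := by ring
        have h2 : t / (1 + t) ≤ 1 := (div_le_one h1t).2 (by linarith)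
        have h3 := mul_le_mul_of_nonneg_left h2 (by positivity : 0 ≤ 2 * n * driftBound q v)
        rw [h]
        linarith

end Chain

theorem stmt_18 {S : Type} [Fintype S] [DecidableEq S] (hS : 2 ≤ Fintype.card S) {n : ℕ}
    (q : S → S → ℝ)
    (hq_nonneg : ∀ i j : S, i ≠ j → 0 ≤ q i j)
    (hq_sym : ∀ i j : S, i ≠ j → (0 < q i j ↔ 0 < q j i))
    (hq_conn : ∀ i j : S, Relation.ReflTransGen (fun a b => a ≠ b ∧ 0 < q a b) i j)
    (v : S → S → (Fin n → ℤ)) (hv : ∀ i j, v j i = -(v i j)) :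
    -- C and T₀ depend only on S, q, n and v:
    ∃ C : ℝ, 0 < C ∧ ∃ T₀ : ℝ, 2 ≤ T₀ ∧
      ∀ (P : S × (Fin n → ℤ) → ℝ → S × (Fin n → ℤ) → ℝ),
        IsTransitionFamily q v P →
        ∀ r : S × (Fin n → ℤ) → ℝ,
          (∀ x, 0 ≤ r x) → (∑' x, r x) = 1 → HentE r ≠ ⊤ →
          (∀ t : ℝ, T₀ ≤ t →
            HentE (fun z => ∑' x, r x * P x t z)
              ≤ ENNReal.ofReal ((HentE r).toReal + C * Real.log t)) ∧
          Tendsto (fun t : ℝ => (HentE (fun z => ∑' x, r x * P x t z)).toReal / t)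
            atTop (nhds 0) := by
  set G : ℝ := Fintype.card S * (∑' a : Fin n → ℤ, ENNReal.ofReal (polyWeight a)).toReal with hG
  have hG0 : 0 ≤ G := by positivity
  have hD := driftBound_nonneg hq_nonneg v
  set C : ℝ := 2 * n * (2 + driftBound q v) + G + 1 with hC
  have hC0 : 0 < C := by positivity
  have hexp : 2 ≤ Real.exp 1 := by linarith [Real.add_one_le_exp 1]
  refine ⟨C, hC0, Real.exp 1, hexp, fun P hP r hr0 hr1 hrH => ?_⟩
  have hbound : ∀ t : ℝ, Real.exp 1 ≤ t → HentE (fun z => ∑' x, r x * P x t z) ≤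
      ENNReal.ofReal ((HentE r).toReal + C * Real.log t) := by
    intro t ht
    have ht2 : 2 ≤ t := hexp.trans ht
    have ht0 : 0 ≤ t := by linarith
    have hl1 : 1 ≤ Real.log t := (Real.le_log_iff_exp_le (by linarith)).2 ht
    have hl2 : Real.log (1 + t) ≤ 2 * Real.log t := by
      have h := Real.log_le_log (by linarith : 0 < 1 + t) (by nlinarith : 1 + t ≤ t ^ 2)
      rwa [Real.log_pow, Nat.cast_ofNat] at h
    have hmix := HentE_mixture_le (r := r) (p := fun x => P x t)
      (M := ENNReal.ofReal (C * Real.log t)) hr0 hr1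
      (fun x => (((hP.1 x).1 t ht0).1)) (fun x => ((hP.1 x).1 t ht0).2) fun x => by
        refine (HentE_masterSolution_le hq_nonneg v (hP.1 x) (hP.2.1 x).1 ht0).trans
          (ENNReal.ofReal_le_ofReal ?_)
        rw [← hG]
        have h1 : Real.log (1 + t) + driftBound q v ≤ (2 + driftBound q v) * Real.log t := by
          nlinarith
        have h2 := mul_le_mul_of_nonneg_left h1 (by positivity : (0 : ℝ) ≤ 2 * n)
        have h3 := mul_le_mul_of_nonneg_left hl1 hG0
        rw [hC]
        linarith
    rwa [ENNReal.ofReal_add ENNReal.toReal_nonneg (by positivity), ENNReal.ofReal_toReal hrH]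
  refine ⟨hbound, ?_⟩
  have hlim : Tendsto (fun t : ℝ => (HentE r).toReal / t + C * (Real.log t / t)) atTop (nhds 0) := by
    have h1 : Tendsto (fun t : ℝ => (HentE r).toReal / t) atTop (nhds 0) :=
      tendsto_const_nhds.div_atTop tendsto_id
    have h2 : Tendsto (fun t : ℝ => Real.log t / t) atTop (nhds 0) :=
      Real.isLittleO_log_id_atTop.tendsto_div_nhds_zero
    simpa using h1.add (h2.const_mul C)
  refine tendsto_of_tendsto_of_tendsto_of_le_of_le' tendsto_const_nhds hlim ?_ ?_
  · filter_upwards [eventually_ge_atTop 0] with t ht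
    exact div_nonneg ENNReal.toReal_nonneg ht
  · filter_upwards [eventually_ge_atTop (Real.exp 1)] with t ht
    have ht1 : 1 ≤ t := by linarith
    have hnn : 0 ≤ (HentE r).toReal + C * Real.log t :=
      add_nonneg ENNReal.toReal_nonneg (mul_nonneg hC0.le (Real.log_nonneg ht1))
    calc _ ≤ ((HentE r).toReal + C * Real.log t) / t :=
          div_le_div_of_nonneg_right (ENNReal.toReal_le_of_le_ofReal hnn (hbound t ht))
            (by linarith)
      _ = _ := by ring

end
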